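/- For t > 0 and u, v ∈ ℝ, ∫_ℝ e^{tx} Ai(x+u) Ai(x+v) dx = (1/(2√(πt))) exp( t³/12 − (u+v)t/2 − (u−v)²/(4t) ), where Ai is the Airy function. -/

import Mathlib

open MeasureTheory Real Filter

/-- The Airy function, defined by the improper (conditionally convergent) integral
`Ai(x) = (1/π) lim_{R→∞} ∫_0^R cos(u³/3 + xu) du`. -/
noncomputable def Ai (x : ℝ) : ℝ :=
  (1 / π) * limUnder atTop (fun R : ℝ => ∫ u in (0 : ℝ)..R, Real.cos (u ^ 3 / 3 + x * u))

open scoped FourierTransform SchwartzMap ComplexConjugate Topology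

/-- Polynomials times Gaussians are bounded. -/
lemma airy_poly_bound (a : ℝ) (ha : 0 < a) (P : Polynomial ℂ) :
    ∃ C : ℝ, ∀ s : ℝ, ‖P.eval (s : ℂ)‖ * Real.exp (-a * s ^ 2) ≤ C := by
  induction P using Polynomial.induction_on' with
  | add p q hp hq =>
    obtain ⟨C, hC⟩ := hp
    obtain ⟨D, hD⟩ := hq
    refine ⟨C + D, fun s => ?_⟩
    have h1 := hC s
    have h2 := hD s
    rw [Polynomial.eval_add]
    have h3 := mul_le_mul_of_nonneg_right (norm_add_le (p.eval (s : ℂ)) (q.eval (s : ℂ)))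
      (Real.exp_pos (-a * s ^ 2)).le
    linarith
  | monomial n c =>
    refine ⟨‖c‖ * (1 + n.factorial / a ^ n), fun s => ?_⟩
    have hpos : 0 ≤ a * s ^ 2 := by positivity
    have h1 := Real.pow_div_factorial_le_exp (a * s ^ 2) hpos n
    have hE : 1 ≤ Real.exp (a * s ^ 2) := Real.one_le_exp hpos
    have hn : (0 : ℝ) < n.factorial := by exact_mod_cast n.factorial_pos
    have han : 0 < a ^ n := by positivity
    have h2 : (s ^ 2) ^ n ≤ n.factorial / a ^ n * Real.exp (a * s ^ 2) := by
      rw [mul_pow, div_le_iff₀ hn] at h1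
      rw [div_mul_eq_mul_div, le_div_iff₀ han]
      linarith
    have h3 : |s| ^ n ≤ 1 + (s ^ 2) ^ n := by
      have : (s ^ 2) ^ n = (|s| ^ n) ^ 2 := by rw [← sq_abs, ← pow_mul, ← pow_mul, mul_comm]
      rw [this]
      nlinarith [sq_nonneg (|s| ^ n - 1), sq_nonneg (|s| ^ n)]
    have h4 : |s| ^ n ≤ (1 + n.factorial / a ^ n) * Real.exp (a * s ^ 2) := by linarith
    have h5 : |s| ^ n * Real.exp (-a * s ^ 2) ≤ 1 + n.factorial / a ^ n := by
      rw [neg_mul, Real.exp_neg, ← div_eq_mul_inv, div_le_iff₀ (Real.exp_pos _)]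
      exact h4
    rw [Polynomial.eval_monomial, norm_mul, norm_pow, Complex.norm_real, Real.norm_eq_abs,
      mul_assoc]
    exact mul_le_mul_of_nonneg_left h5 (norm_nonneg c)

lemma airy_iteratedDeriv (q : Polynomial ℂ) (n : ℕ) :
    ∃ P : Polynomial ℂ, iteratedDeriv n (fun s : ℝ => Complex.exp (q.eval (s : ℂ)))
      = fun s : ℝ => P.eval (s : ℂ) * Complex.exp (q.eval (s : ℂ)) := by
  induction n with
  | zero => exact ⟨1, by ext s; simp⟩
  | succ n ih =>
    obtain ⟨P, hP⟩ := ih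
    refine ⟨P.derivative + P * q.derivative, ?_⟩
    rw [iteratedDeriv_succ, hP]
    ext s
    have h1 : HasDerivAt (fun z : ℂ => P.eval z * Complex.exp (q.eval z)) _ (s : ℂ) :=
      (P.hasDerivAt (s : ℂ)).mul ((q.hasDerivAt (s : ℂ)).cexp)
    rw [h1.comp_ofReal.deriv]
    simp only [Polynomial.eval_add, Polynomial.eval_mul]
    ring

/-- The exponent of the shifted Airy integrand. -/
noncomputable def airyPoly (a w : ℝ) : Polynomial ℂ :=
  Polynomial.C Complex.I * ((Polynomial.X + Polynomial.C ((a : ℂ) * Complex.I)) ^ 3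
      * Polynomial.C (1 / 3 : ℂ)
    + Polynomial.C (w : ℂ) * (Polynomial.X + Polynomial.C ((a : ℂ) * Complex.I)))

/-- The Airy integrand as an entire function. -/
noncomputable def airyF (w : ℝ) (z : ℂ) : ℂ :=
  Complex.exp (Complex.I * (z ^ 3 / 3 + w * z))

lemma airyPoly_eval (a w : ℝ) (z : ℂ) :
    Complex.exp ((airyPoly a w).eval z) = airyF w (z + a * Complex.I) := by
  simp only [airyPoly, airyF, Polynomial.eval_mul, Polynomial.eval_add, Polynomial.eval_pow,
    Polynomial.eval_C, Polynomial.eval_X]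
  congr 1
  ring

lemma airyF_norm (w s y : ℝ) :
    ‖airyF w (s + y * Complex.I)‖ = Real.exp (y ^ 3 / 3 - w * y) * Real.exp (-y * s ^ 2) := by
  rw [airyF, Complex.norm_exp, ← Real.exp_add]
  congr 1
  have : Complex.I * (((s : ℂ) + y * Complex.I) ^ 3 / 3 + w * (s + y * Complex.I))
      = ((y ^ 3 / 3 - w * y + -y * s ^ 2 : ℝ) : ℂ)
        + ((s ^ 3 / 3 - s * y ^ 2 + w * s : ℝ) : ℂ) * Complex.I := by
    push_cast
    linear_combination ((s : ℂ) ^ 2 * y + s * y ^ 2 * Complex.I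
      + (y : ℂ) ^ 3 / 3 * (Complex.I ^ 2 - 1) + w * y) * Complex.I_sq
  rw [this, Complex.add_re, Complex.ofReal_re, Complex.re_ofReal_mul, Complex.I_re, mul_zero, add_zero]

/-- The shifted Airy integrand as a Schwartz function. -/
noncomputable def airyG (a w : ℝ) (ha : 0 < a) : 𝓢(ℝ, ℂ) where
  toFun s := airyF w (s + a * Complex.I)
  smooth' := by
    unfold airyF
    have : ContDiff ℝ (⊤ : ℕ∞) (fun s : ℝ => (s : ℂ)) := Complex.ofRealCLM.contDiff
    fun_prop
  decay' := by
    intro k n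
    obtain ⟨P, hP⟩ := airy_iteratedDeriv (airyPoly a w) n
    simp only [airyPoly_eval] at hP
    obtain ⟨C, hC⟩ := airy_poly_bound a ha (Polynomial.X ^ k * P)
    refine ⟨Real.exp (a ^ 3 / 3 - w * a) * C, fun s => ?_⟩
    rw [norm_iteratedFDeriv_eq_norm_iteratedDeriv, hP, norm_mul, airyF_norm]
    have h := mul_le_mul_of_nonneg_left (hC s) (Real.exp_pos (a ^ 3 / 3 - w * a)).le
    simp only [Polynomial.eval_mul, Polynomial.eval_pow, Polynomial.eval_X, norm_mul, norm_pow,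
      Complex.norm_real] at h
    refine le_trans (le_of_eq ?_) h
    ring

lemma airyG_apply (a w : ℝ) (ha : 0 < a) (s : ℝ) :
    airyG a w ha s = airyF w (s + a * Complex.I) := rfl

lemma airyF_differentiable (w : ℝ) : Differentiable ℂ (airyF w) := by
  unfold airyF
  fun_prop

lemma airyF_continuous (w : ℝ) : Continuous (airyF w) := (airyF_differentiable w).continuous

lemma airy_vert (a w : ℝ) (ha : 0 < a) (σ : ℝ) (hσ : σ ^ 2 = 1) :
    Tendsto (fun R : ℝ => ∫ y in (0 : ℝ)..a, airyF w (((σ * R : ℝ) : ℂ) + y * Complex.I))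
      atTop (𝓝 0) := by
  have h0 : (∫ y in (0 : ℝ)..a, (0 : ℂ)) = 0 := by simp
  rw [← h0]
  have hs : ∀ R : ℝ, (σ * R) ^ 2 = R ^ 2 := fun R => by rw [mul_pow, hσ, one_mul]
  refine intervalIntegral.tendsto_integral_filter_of_dominated_convergence
    (fun y => Real.exp (y ^ 3 / 3 - w * y)) ?_ ?_ ?_ ?_
  · refine Eventually.of_forall fun R => ?_
    have hc := airyF_continuous w
    exact (Continuous.aestronglyMeasurable (by fun_prop))
  · refine Eventually.of_forall fun R => Eventually.of_forall fun y hy => ?_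
    rw [Set.uIoc_of_le ha.le] at hy
    rw [airyF_norm]
    refine mul_le_of_le_one_right (Real.exp_pos _).le (Real.exp_le_one_iff.2 ?_)
    nlinarith [mul_nonneg hy.1.le (sq_nonneg (σ * R))]
  · exact Continuous.intervalIntegrable (by fun_prop) _ _
  · refine Eventually.of_forall fun y hy => ?_
    rw [Set.uIoc_of_le ha.le] at hy
    rw [tendsto_zero_iff_norm_tendsto_zero]
    simp only [airyF_norm, hs]
    rw [← mul_zero (Real.exp (y ^ 3 / 3 - w * y))]
    refine Tendsto.const_mul _ (Real.tendsto_exp_atBot.comp ?_)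
    exact (tendsto_pow_atTop (two_ne_zero)).const_mul_atTop_of_neg (by linarith [hy.1])

lemma airyF_real_cos (w R : ℝ) :
    (∫ s in (-R)..R, airyF w (s : ℂ))
      = ((2 * ∫ s in (0 : ℝ)..R, Real.cos (s ^ 3 / 3 + w * s) : ℝ) : ℂ) := by
  have hc := airyF_continuous w
  have hi : ∀ b c : ℝ, IntervalIntegrable (fun s : ℝ => airyF w (s : ℂ)) volume b c :=
    fun b c => Continuous.intervalIntegrable (by fun_prop) _ _
  have hi' : ∀ b c : ℝ, IntervalIntegrable (fun s : ℝ => airyF w ((-s : ℝ) : ℂ)) volume b c :=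
    fun b c => Continuous.intervalIntegrable (by fun_prop) _ _
  rw [← intervalIntegral.integral_add_adjacent_intervals (hi (-R) 0) (hi 0 R)]
  have h1 : (∫ s in (-R)..0, airyF w (s : ℂ)) = ∫ s in (0 : ℝ)..R, airyF w ((-s : ℝ) : ℂ) := by
    rw [intervalIntegral.integral_comp_neg (fun s : ℝ => airyF w (s : ℂ))]
    simp
  rw [h1, ← intervalIntegral.integral_add (hi' 0 R) (hi 0 R),
    ← intervalIntegral.integral_const_mul, ← intervalIntegral.integral_ofReal]
  congr 1
  ext s
  push_cast
  rw [Complex.two_cos]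
  simp only [airyF]
  rw [add_comm]
  congr 2 <;> ring

lemma Ai_eq (a w : ℝ) (ha : 0 < a) :
    (∫ s : ℝ, airyG a w ha s) = ((2 * π * Ai w : ℝ) : ℂ) := by
  set J := ∫ s : ℝ, airyG a w ha s with hJ
  have hint : Integrable (fun s : ℝ => airyG a w ha s) := (airyG a w ha).integrable
  have ht : Tendsto (fun R : ℝ => ∫ s in (-R)..R, airyG a w ha s) atTop (𝓝 J) :=
    intervalIntegral_tendsto_integral hint tendsto_neg_atTop_atBot tendsto_id
  have hrect : ∀ R : ℝ, (∫ s in (-R)..R, airyF w (s : ℂ))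
      = (∫ s in (-R)..R, airyG a w ha s)
        - Complex.I * (∫ y in (0 : ℝ)..a, airyF w (((1 * R : ℝ) : ℂ) + y * Complex.I))
        + Complex.I * (∫ y in (0 : ℝ)..a, airyF w (((-1 * R : ℝ) : ℂ) + y * Complex.I)) := by
    intro R
    have h := Complex.integral_boundary_rect_eq_zero_of_differentiableOn (airyF w)
      ((-R : ℝ) : ℂ) ((R : ℂ) + a * Complex.I) (airyF_differentiable w).differentiableOn
    simp only [Complex.ofReal_re, Complex.ofReal_im, Complex.add_re, Complex.add_im,
      Complex.mul_re, Complex.mul_im, Complex.I_re, Complex.I_im, mul_zero, mul_one, zero_mul,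
      sub_zero, add_zero, zero_add, Complex.ofReal_zero, smul_eq_mul] at h
    simp only [airyG_apply, one_mul, neg_one_mul]
    linear_combination h
  have hlim : Tendsto (fun R : ℝ => ∫ s in (-R)..R, airyF w (s : ℂ)) atTop (𝓝 J) := by
    have := (ht.sub ((airy_vert a w ha 1 (by norm_num)).const_mul Complex.I)).add
      ((airy_vert a w ha (-1) (by norm_num)).const_mul Complex.I)
    simp only [mul_zero, sub_zero, add_zero] at this
    exact this.congr fun R => (hrect R).symm
  simp only [airyF_real_cos] at hlim
  have hre : Tendsto (fun R : ℝ => ∫ s in (0 : ℝ)..R, Real.cos (s ^ 3 / 3 + w * s)) atTop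
      (𝓝 (J.re / 2)) := by
    have := ((Complex.continuous_re.tendsto J).comp hlim).div_const 2
    refine this.congr fun R => ?_
    simp only [Function.comp_apply, Complex.ofReal_re]
    ring
  have him : J.im = 0 := by
    have := (Complex.continuous_im.tendsto J).comp hlim
    refine (tendsto_nhds_unique this ?_)
    refine tendsto_const_nhds.congr fun R => ?_
    simp only [Function.comp_apply, Complex.ofReal_im]
  have hA : 2 * π * Ai w = J.re := by
    rw [Ai, hre.limUnder_eq]
    field_simp
  rw [hA]
  apply Complex.ext <;> simp [him]

lemma fourier_airyG (a w : ℝ) (ha : 0 < a) (ξ : ℝ) :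
    (𝓕 (airyG a w ha)) ξ
      = ((2 * π * (Real.exp (-(2 * π * ξ) * a) * Ai (w - 2 * π * ξ)) : ℝ) : ℂ) := by
  have h := Ai_eq a (w - 2 * π * ξ) ha
  rw [SchwartzMap.fourier_coe, Real.fourier_real_eq_integral_exp_smul]
  have h2 : ((2 * π * (Real.exp (-(2 * π * ξ) * a) * Ai (w - 2 * π * ξ)) : ℝ) : ℂ)
      = Complex.exp (((-(2 * π * ξ) * a : ℝ)) : ℂ) * ((2 * π * Ai (w - 2 * π * ξ) : ℝ) : ℂ) := by
    push_cast
    ring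
  rw [h2, ← h, ← integral_const_mul]
  congr 1
  ext s
  simp only [airyG_apply, airyF, smul_eq_mul]
  rw [← Complex.exp_add, ← Complex.exp_add]
  congr 1
  push_cast
  linear_combination (2 * π * ξ * a : ℂ) * Complex.I_sq

lemma airyG_inner (a u v : ℝ) (ha : 0 < a) (s : ℝ) :
    inner ℂ (airyG a u ha s) (airyG a v ha s)
      = Complex.exp (((-(2 * a) : ℝ) : ℂ) * (s : ℂ) ^ 2 + (((v - u : ℝ) : ℂ) * Complex.I) * s
        + ((2 * a ^ 3 / 3 - a * (u + v) : ℝ) : ℂ)) := by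
  rw [RCLike.inner_apply]
  simp only [airyG_apply, airyF]
  rw [← Complex.exp_conj, ← Complex.exp_add]
  congr 1
  simp only [map_mul, map_add, map_div₀, map_pow, Complex.conj_I, Complex.conj_ofReal,
    map_ofNat]
  push_cast
  linear_combination (2 * a * (s : ℂ) ^ 2 + (u + v) * a
    + 2 * (a : ℂ) ^ 3 / 3 * (Complex.I ^ 2 - 1)) * Complex.I_sq

/-- Laplace-transform identity for products of Airy functions: for `t > 0` and `u, v ∈ ℝ`,
`∫_ℝ e^{tx} Ai(x+u) Ai(x+v) dx = (2√(πt))⁻¹ exp(t³/12 − (u+v)t/2 − (u−v)²/(4t))`. -/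
theorem airy_laplace_transform (t u v : ℝ) (ht : 0 < t) :
    (∫ x : ℝ, Real.exp (t * x) * Ai (x + u) * Ai (x + v))
      = (1 / (2 * Real.sqrt (π * t))) *
        Real.exp (t ^ 3 / 12 - (u + v) * t / 2 - (u - v) ^ 2 / (4 * t)) := by
  have ha : 0 < t / 2 := by positivity
  have hP := SchwartzMap.integral_inner_fourier_fourier (airyG (t / 2) u ha) (airyG (t / 2) v ha)
  simp only [fourier_airyG, airyG_inner] at hP
  rw [integral_cexp_quadratic (by simp; linarith)] at hP
  have hL : ∀ ξ : ℝ, inner ℂ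
      ((2 * π * (Real.exp (-(2 * π * ξ) * (t / 2)) * Ai (u - 2 * π * ξ)) : ℝ) : ℂ)
      ((2 * π * (Real.exp (-(2 * π * ξ) * (t / 2)) * Ai (v - 2 * π * ξ)) : ℝ) : ℂ)
      = (((fun x : ℝ => (2 * π) ^ 2 * (Real.exp (t * x) * Ai (x + u) * Ai (x + v)))
          (-(2 * π) * ξ) : ℝ) : ℂ) := by
    intro ξ
    have e : Real.exp (t * (-(2 * π) * ξ))
        = Real.exp (-(2 * π * ξ) * (t / 2)) * Real.exp (-(2 * π * ξ) * (t / 2)) := by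
      rw [← Real.exp_add]
      congr 1
      ring
    rw [RCLike.inner_apply, Complex.conj_ofReal, ← Complex.ofReal_mul]
    congr 1
    simp only [e]
    rw [show -(2 * π) * ξ + u = u - 2 * π * ξ by ring,
      show -(2 * π) * ξ + v = v - 2 * π * ξ by ring]
    ring
  rw [integral_congr_ae (Eventually.of_forall hL), integral_complex_ofReal,
    Measure.integral_comp_mul_left
      (fun x : ℝ => (2 * π) ^ 2 * (Real.exp (t * x) * Ai (x + u) * Ai (x + v))),
    integral_const_mul] at hP
  have hR : ((π : ℂ) / -((-(2 * (t / 2)) : ℝ) : ℂ)) ^ (1 / 2 : ℂ) = ((√(π / t) : ℝ) : ℂ) := by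
    rw [Real.sqrt_eq_rpow, Complex.ofReal_cpow (by positivity)]
    congr 1
    · push_cast
      congr 1
      ring
    · norm_num
  have hE : ((2 * (t / 2) ^ 3 / 3 - t / 2 * (u + v) : ℝ) : ℂ)
      - (((v - u : ℝ) : ℂ) * Complex.I) ^ 2 / (4 * ((-(2 * (t / 2)) : ℝ) : ℂ))
      = ((t ^ 3 / 12 - (u + v) * t / 2 - (u - v) ^ 2 / (4 * t) : ℝ) : ℂ) := by
    have : (t : ℂ) ≠ 0 := by exact_mod_cast ht.ne'
    rw [mul_pow, Complex.I_sq]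
    push_cast
    field_simp
    ring
  rw [hR, hE, ← Complex.ofReal_exp, ← Complex.ofReal_mul] at hP
  have hP' := Complex.ofReal_injective hP
  have hpi := Real.pi_pos
  have habs : |(-(2 * π))⁻¹| = (2 * π)⁻¹ := by
    rw [abs_inv, abs_neg, abs_of_pos (by positivity)]
  rw [habs, smul_eq_mul] at hP'
  have hS : √(π / t) = 2 * π * (1 / (2 * √(π * t))) := by
    rw [Real.sqrt_div hpi.le, Real.sqrt_mul hpi.le]
    have h1 : 0 < √π := Real.sqrt_pos.2 hpi
    have h2 : 0 < √t := Real.sqrt_pos.2 ht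
    have h3 : √π ^ 2 = π := Real.sq_sqrt hpi.le
    field_simp
    linarith
  rw [hS] at hP'
  have h2pi : (2 * π) ≠ 0 := by positivity
  apply mul_left_cancel₀ h2pi
  rw [← mul_assoc, ← hP']
  field_simp
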